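/- arXiv:2202.10614 — 4 statements merged into one kernel-verified Lean document; each statement's English description precedes it below -/
import Mathlib

section
/- Let G be a finite bipartite multigraph. Then the set 𝖫_G of nonnegative solutions of the linear system L_G is exactly the convex hull in the real vector space E → ℝ of the finite set { t_M | M a perfect matching of G } of points associated to perfect matchings. (Lemma: 𝖫_G = convexHull ℝ { t_M | M perfect matching }.) -/
open Finset

variable {Vp Vn E : Type*} [Fintype Vp] [Fintype Vn] [Fintype E]
  [DecidableEq Vp] [DecidableEq Vn] [DecidableEq E]

/-- `t : E → ℝ` solves the linear system `L_G`: at every positive vertex `v` the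
weights of the edges incident to `v` sum to `2`, and similarly for negative vertices. -/
def SolvesLG (p : E → Vp) (q : E → Vn) (t : E → ℝ) : Prop :=
  (∀ v : Vp, ∑ e ∈ Finset.univ.filter (fun e => p e = v), t e = 2) ∧
  (∀ v : Vn, ∑ e ∈ Finset.univ.filter (fun e => q e = v), t e = 2)

/-- The set `𝖫_G` of nonnegative solutions of `L_G`. -/
def LGset (p : E → Vp) (q : E → Vn) : Set (E → ℝ) :=
  {t | SolvesLG p q t ∧ ∀ e, 0 ≤ t e}

/-- `M` is a perfect matching of `G`: every positive vertex is the `p`-endpoint of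
exactly one edge of `M`, and every negative vertex is the `q`-endpoint of exactly one
edge of `M`. -/
def IsPerfectMatching (p : E → Vp) (q : E → Vn) (M : Set E) : Prop :=
  (∀ v : Vp, ∃! e, e ∈ M ∧ p e = v) ∧ (∀ v : Vn, ∃! e, e ∈ M ∧ q e = v)

/-- The point `t_M` associated to a perfect matching `M`: value `2` on edges of `M`
and `0` elsewhere. -/
noncomputable def tM (M : Set E) : E → ℝ := M.indicator fun _ => 2

set_option linter.unusedSectionVars false

theorem sum_filter_tM {V : Type*} [DecidableEq V] (r : E → V) (M : Set E) (v : V)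
    (h : ∃! e, e ∈ M ∧ r e = v) :
    ∑ e ∈ Finset.univ.filter (fun e => r e = v), tM M e = 2 := by
  obtain ⟨e, ⟨heM, hev⟩, hu⟩ := h
  rw [Finset.sum_eq_single_of_mem e (by simp [hev])]
  · simp [tM, heM]
  · intro b hb hbe
    have hbM : b ∉ M := fun hM => hbe (hu b ⟨hM, by simpa using hb⟩)
    simp [tM, hbM]

theorem tM_nonneg (M : Set E) (e : E) : 0 ≤ tM M e :=
  Set.indicator_nonneg (fun _ _ => zero_le_two) e

theorem IsPerfectMatching.tM_mem_LGset {p : E → Vp} {q : E → Vn} {M : Set E}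
    (hM : IsPerfectMatching p q M) : tM M ∈ LGset p q :=
  ⟨⟨fun v => sum_filter_tM p M v (hM.1 v), fun v => sum_filter_tM q M v (hM.2 v)⟩, tM_nonneg M⟩

/-- If every vertex has total weight `2`, the edges with an endpoint in `A` have total
weight `2 * #A`. -/
theorem sum_filter_mem_eq_two_mul_card {V : Type*} [DecidableEq V] {r : E → V} {t : E → ℝ}
    (h : ∀ v, ∑ e ∈ Finset.univ.filter (fun e => r e = v), t e = 2) (A : Finset V) :
    ∑ e ∈ Finset.univ.filter (fun e => r e ∈ A), t e = 2 * #A := by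
  rw [← Finset.sum_fiberwise_eq_sum_filter]
  simp [h, mul_comm]

theorem SolvesLG.card_eq {p : E → Vp} {q : E → Vn} {t : E → ℝ} (h : SolvesLG p q t) :
    Fintype.card Vp = Fintype.card Vn := by
  have hp := sum_filter_mem_eq_two_mul_card h.1 Finset.univ
  have hq := sum_filter_mem_eq_two_mul_card h.2 Finset.univ
  simp only [Finset.mem_univ, Finset.filter_true, Finset.card_univ] at hp hq
  have : (Fintype.card Vp : ℝ) = Fintype.card Vn := by linarith
  exact_mod_cast this

/-- The support of a nonnegative solution of `L_G` contains a perfect matching. -/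
theorem exists_isPerfectMatching_of_mem_LGset {p : E → Vp} {q : E → Vn} {t : E → ℝ}
    (ht : t ∈ LGset p q) : ∃ M, IsPerfectMatching p q M ∧ ∀ e ∈ M, 0 < t e := by
  obtain ⟨hL, h0⟩ := ht
  let f (v : Vp) : Finset Vn := (Finset.univ.filter fun e => p e = v ∧ 0 < t e).image q
  have hall (A : Finset Vp) : #A ≤ #(A.biUnion f) := by
    have hle : ∑ e ∈ Finset.univ.filter (fun e => p e ∈ A), t e ≤
        ∑ e ∈ Finset.univ.filter (fun e => q e ∈ A.biUnion f), t e := by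
      rw [Finset.sum_filter, Finset.sum_filter]
      refine Finset.sum_le_sum fun e _ => ?_
      by_cases hA : p e ∈ A
      · rcases (h0 e).eq_or_lt with he | he
        · simp [← he]
        · have hq : q e ∈ A.biUnion f :=
            Finset.mem_biUnion.2 ⟨p e, hA, Finset.mem_image_of_mem q (by simp [he])⟩
          rw [if_pos hA, if_pos hq]
      · rw [if_neg hA]
        split_ifs
        exacts [h0 e, le_rfl]
    rw [sum_filter_mem_eq_two_mul_card hL.1, sum_filter_mem_eq_two_mul_card hL.2] at hle
    have : (#A : ℝ) ≤ #(A.biUnion f) := by linarith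
    exact_mod_cast this
  obtain ⟨g, hg, hgf⟩ := (Finset.all_card_le_biUnion_card_iff_exists_injective f).1 hall
  have hbij : Function.Bijective g :=
    (Fintype.bijective_iff_injective_and_card g).2 ⟨hg, hL.card_eq⟩
  have hedge (v : Vp) : ∃ e, p e = v ∧ 0 < t e ∧ q e = g v := by
    simpa [f, and_assoc] using hgf v
  choose m hmp hmt hmq using hedge
  refine ⟨Set.range m, ⟨fun v => ⟨m v, ⟨⟨v, rfl⟩, hmp v⟩, ?_⟩, fun w => ?_⟩, ?_⟩
  · rintro _ ⟨⟨u, rfl⟩, hu⟩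
    rw [← hu, hmp]
  · obtain ⟨v, rfl⟩ := hbij.2 w
    refine ⟨m v, ⟨⟨v, rfl⟩, hmq v⟩, ?_⟩
    rintro _ ⟨⟨u, rfl⟩, hu⟩
    rw [hg ((hmq u).symm.trans hu)]
  · rintro _ ⟨v, rfl⟩
    exact hmt v

theorem convex_LGset (p : E → Vp) (q : E → Vn) : Convex ℝ (LGset p q) := by
  rintro x ⟨⟨hxp, hxq⟩, hx0⟩ y ⟨⟨hyp, hyq⟩, hy0⟩ a b ha hb hab
  refine ⟨⟨fun v => ?_, fun v => ?_⟩, fun e => ?_⟩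
  · simp only [Pi.add_apply, Pi.smul_apply, smul_eq_mul, Finset.sum_add_distrib,
      ← Finset.mul_sum, hxp, hyp]
    linarith
  · simp only [Pi.add_apply, Pi.smul_apply, smul_eq_mul, Finset.sum_add_distrib,
      ← Finset.mul_sum, hxq, hyq]
    linarith
  · exact add_nonneg (mul_nonneg ha (hx0 e)) (mul_nonneg hb (hy0 e))

theorem isCompact_LGset (p : E → Vp) (q : E → Vn) : IsCompact (LGset p q) := by
  refine (isCompact_Icc (a := (0 : E → ℝ)) (b := fun _ => 2)).of_isClosed_subset ?_ ?_
  · simp only [LGset, SolvesLG, Set.ofPred_and, Set.ofPred_forall]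
    refine ((isClosed_iInter fun v => ?_).inter (isClosed_iInter fun v => ?_)).inter
      (isClosed_iInter fun e => isClosed_le continuous_const (continuous_apply e))
    all_goals exact isClosed_eq (by fun_prop) continuous_const
  · rintro t ⟨⟨hp, -⟩, h0⟩
    refine ⟨h0, fun e => ?_⟩
    rw [← hp (p e)]
    exact Finset.single_le_sum (fun i _ => h0 i) (by simp)

/-- Every extreme point of `𝖫_G` is the point associated to a perfect matching. -/
theorem extremePoints_LGset_subset (p : E → Vp) (q : E → Vn) :
    (LGset p q).extremePoints ℝ ⊆ {t | ∃ M : Set E, IsPerfectMatching p q M ∧ t = tM M} := by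
  rintro t ⟨ht, hext⟩
  obtain ⟨M, hM, hpos⟩ := exists_isPerfectMatching_of_mem_LGset ht
  refine ⟨M, hM, ?_⟩
  obtain ⟨ε, hε, hle⟩ : ∃ ε : ℝ, 0 < ε ∧ ∀ e, ε * tM M e ≤ t e := by
    have hev : ∀ᶠ ε in nhdsWithin (0 : ℝ) (Set.Ioi 0), ∀ e, ε * tM M e ≤ t e := by
      refine Filter.eventually_all.2 fun e => ?_
      by_cases he : e ∈ M
      · have hlt : ∀ᶠ ε in nhds (0 : ℝ), ε * tM M e < t e :=
          (continuous_id.mul continuous_const).continuousAt.eventually_lt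
            continuousAt_const (by simpa using hpos e he)
        exact (hlt.filter_mono nhdsWithin_le_nhds).mono fun _ h => h.le
      · simp [tM, he, ht.2 e]
    obtain ⟨ε, h, hε⟩ := (hev.and self_mem_nhdsWithin).exists
    exact ⟨ε, hε, h⟩
  have hmem : (1 + ε) • t - ε • tM M ∈ LGset p q := by
    have htM := hM.tM_mem_LGset
    refine ⟨⟨fun v => ?_, fun v => ?_⟩, fun e => ?_⟩
    · simp only [Pi.sub_apply, Pi.smul_apply, smul_eq_mul, Finset.sum_sub_distrib,
        ← Finset.mul_sum, ht.1.1 v, htM.1.1 v]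
      ring
    · simp only [Pi.sub_apply, Pi.smul_apply, smul_eq_mul, Finset.sum_sub_distrib,
        ← Finset.mul_sum, ht.1.2 v, htM.1.2 v]
      ring
    · simp only [Pi.sub_apply, Pi.smul_apply, smul_eq_mul]
      linarith [hle e, mul_nonneg hε.le (ht.2 e)]
  refine (hext hM.tM_mem_LGset hmem
    ⟨ε / (1 + ε), 1 / (1 + ε), by positivity, by positivity, by field_simp; ring, ?_⟩).symm
  ext e
  simp only [Pi.add_apply, Pi.sub_apply, Pi.smul_apply, smul_eq_mul]
  field_simp
  ring

/-- The set of nonnegative solutions of `L_G` is the convex hull of the points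
associated to the perfect matchings of `G`. -/
theorem LGset_eq_convexHull_perfectMatchings (p : E → Vp) (q : E → Vn) :
    LGset p q =
      convexHull ℝ {t : E → ℝ | ∃ M : Set E, IsPerfectMatching p q M ∧ t = tM M} := by
  apply Set.Subset.antisymm
  · have hfin : {t : E → ℝ | ∃ M : Set E, IsPerfectMatching p q M ∧ t = tM M}.Finite :=
      (Set.finite_range (tM : Set E → E → ℝ)).subset fun _ ⟨M, _, h⟩ => ⟨M, h.symm⟩
    rw [← closure_convexHull_extremePoints (isCompact_LGset p q) (convex_LGset p q)]
    exact closure_minimal (convexHull_mono (extremePoints_LGset_subset p q))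
      (hfin.isCompact_convexHull ℝ).isClosed
  · refine convexHull_min ?_ (convex_LGset p q)
    rintro _ ⟨M, hM, rfl⟩
    exact hM.tM_mem_LGset
end

section
/- Let G be a finite bipartite multigraph that is connected and is a tree, i.e. G is connected and the number of edges satisfies card E = card V₊ + card V₋ − 1. Then the linear system L_G has at most one solution t : E → ℝ (even without imposing nonnegativity); in particular 𝖫_G contains at most one point. -/
open Finset

variable {Vp Vn E : Type*} [Fintype Vp] [Fintype Vn] [Fintype E]
  [DecidableEq Vp] [DecidableEq Vn] [DecidableEq E]

/-- The one-step adjacency relation on the vertex set `Vp ⊕ Vn`: the two endpoints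
of an edge are related. -/
def EdgeRel (p : E → Vp) (q : E → Vn) : (Vp ⊕ Vn) → (Vp ⊕ Vn) → Prop :=
  fun v w => ∃ e : E,
    (v = Sum.inl (p e) ∧ w = Sum.inr (q e)) ∨ (v = Sum.inr (q e) ∧ w = Sum.inl (p e))

/-- `G` is connected: the reflexive-transitive closure of the adjacency relation
relates every pair of vertices. -/
def IsConnectedGraph (p : E → Vp) (q : E → Vn) : Prop :=
  ∀ v w : Vp ⊕ Vn, Relation.ReflTransGen (EdgeRel p q) v w

/-- The coboundary map, sending a potential `y` on the vertices to its differences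
along the edges. -/
def coboundary {P N F : Type*} (p : F → P) (q : F → N) : (P ⊕ N → ℝ) →ₗ[ℝ] (F → ℝ) :=
  LinearMap.funLeft ℝ ℝ (fun e => Sum.inl (p e)) - LinearMap.funLeft ℝ ℝ (fun e => Sum.inr (q e))

theorem coboundary_apply {P N F : Type*} (p : F → P) (q : F → N) (y : P ⊕ N → ℝ) (e : F) :
    coboundary p q y e = y (Sum.inl (p e)) - y (Sum.inr (q e)) := rfl

/-- On a connected graph, potentials with zero coboundary are constant. -/
theorem ker_coboundary_le_span_one {P N F : Type*} (p : F → P) (q : F → N)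
    (hconn : IsConnectedGraph p q) :
    LinearMap.ker (coboundary p q) ≤ Submodule.span ℝ {1} := by
  intro y hy
  have hedge (e : F) : y (Sum.inl (p e)) = y (Sum.inr (q e)) :=
    sub_eq_zero.mp (congrFun (LinearMap.mem_ker.mp hy) e)
  have hconst (v w : P ⊕ N) : y v = y w := by
    induction hconn v w with
    | refl => rfl
    | tail _ hstep ih =>
      obtain ⟨e, ⟨rfl, rfl⟩ | ⟨rfl, rfl⟩⟩ := hstep
      · exact ih.trans (hedge e)
      · exact ih.trans (hedge e).symm
  rw [Submodule.mem_span_singleton]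
  rcases isEmpty_or_nonempty (P ⊕ N) with _ | ⟨⟨v⟩⟩
  · exact ⟨0, Subsingleton.elim _ _⟩
  · exact ⟨y v, funext fun w => by simp [hconst v w]⟩

/-- On a tree, every function on the edges is a coboundary. -/
theorem coboundary_surjective_of_tree {P N F : Type*} [Fintype P] [Fintype N] [Fintype F]
    (p : F → P) (q : F → N) (hconn : IsConnectedGraph p q)
    (htree : Fintype.card F = Fintype.card P + Fintype.card N - 1) :
    Function.Surjective (coboundary p q) := by
  have hker : Module.finrank ℝ (LinearMap.ker (coboundary p q)) ≤ 1 :=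
    (Submodule.finrank_mono (ker_coboundary_le_span_one p q hconn)).trans
      (by simpa using finrank_span_le_card (R := ℝ) ({1} : Set (P ⊕ N → ℝ)))
  have hsum := LinearMap.finrank_range_add_finrank_ker (coboundary p q)
  have hle := Submodule.finrank_le (LinearMap.range (coboundary p q))
  rw [← LinearMap.range_eq_top]
  apply Submodule.eq_top_of_finrank_eq
  simp only [Module.finrank_fintype_fun_eq_card, Fintype.card_sum] at hsum hle ⊢
  lia

/-- If the sums of `d` over the fibres of `f` vanish, then `d` is orthogonal to every
function that factors through `f`. -/
theorem sum_comp_mul_eq_zero {F V : Type*} [Fintype F] [Fintype V] [DecidableEq V]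
    (f : F → V) (d : F → ℝ) (hd : ∀ v, ∑ e ∈ Finset.univ.filter (fun e => f e = v), d e = 0)
    (y : V → ℝ) : ∑ e, y (f e) * d e = 0 := by
  rw [← Finset.sum_fiberwise (s := Finset.univ) (g := f)]
  refine Finset.sum_eq_zero fun v _ => ?_
  have hfiber : ∀ e ∈ Finset.univ.filter (fun e => f e = v), y (f e) * d e = y v * d e := by
    intro e he
    rw [(Finset.mem_filter.mp he).2]
  rw [Finset.sum_congr rfl hfiber, ← Finset.mul_sum, hd, mul_zero]

/-- If `G` is a connected tree, then the linear system `L_G` has at most one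
solution (even without nonnegativity). -/
theorem solvesLG_unique_of_tree (p : E → Vp) (q : E → Vn)
    (hconn : IsConnectedGraph p q)
    (htree : Fintype.card E = Fintype.card Vp + Fintype.card Vn - 1) :
    ∀ t₁ t₂ : E → ℝ, SolvesLG p q t₁ → SolvesLG p q t₂ → t₁ = t₂ := by
  intro t₁ t₂ h₁ h₂
  obtain ⟨y, hy⟩ := coboundary_surjective_of_tree p q hconn htree (t₁ - t₂)
  have hp := sum_comp_mul_eq_zero p (t₁ - t₂)
    (fun v => by simp [Finset.sum_sub_distrib, h₁.1 v, h₂.1 v]) (fun v => y (Sum.inl v))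
  have hq := sum_comp_mul_eq_zero q (t₁ - t₂)
    (fun v => by simp [Finset.sum_sub_distrib, h₁.2 v, h₂.2 v]) (fun v => y (Sum.inr v))
  have hsq : ∑ e, (t₁ - t₂) e * (t₁ - t₂) e = 0 := by
    calc ∑ e, (t₁ - t₂) e * (t₁ - t₂) e
        = ∑ e, (y (Sum.inl (p e)) - y (Sum.inr (q e))) * (t₁ - t₂) e :=
          Finset.sum_congr rfl fun e _ => by rw [← coboundary_apply, hy]
      _ = 0 := by simp only [sub_mul, Finset.sum_sub_distrib, hp, hq, sub_zero]
  rw [Finset.sum_eq_zero_iff_of_nonneg fun e _ => mul_self_nonneg _] at hsq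
  exact funext fun e => sub_eq_zero.mp (mul_self_eq_zero.mp (hsq e (Finset.mem_univ e)))
end

section
/- Let G be a finite bipartite multigraph, let t ∈ 𝖫_G be a nonnegative solution of L_G, and let e₀ be an edge with t e₀ ∉ {0, 2}. Then each endpoint of e₀ is incident to another such edge: there exists an edge e₁ ≠ e₀ with p e₁ = p e₀ and t e₁ ∉ {0, 2}, and there exists an edge e₂ ≠ e₀ with q e₂ = q e₀ and t e₂ ∉ {0, 2}. -/
open Finset

variable {Vp Vn E : Type*} [Fintype Vp] [Fintype Vn] [Fintype E]
  [DecidableEq Vp] [DecidableEq Vn] [DecidableEq E]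

/-- If nonnegative weights on `s` sum to `c` and one of them is neither `0` nor `c`, then so is
another one. -/
theorem Finset.exists_ne_and_ne_zero_and_ne_of_sum_eq {ι : Type*} {s : Finset ι} {t : ι → ℝ}
    {c : ℝ} (ht : ∀ i ∈ s, 0 ≤ t i) (hsum : ∑ i ∈ s, t i = c) {i₀ : ι} (hi₀ : i₀ ∈ s)
    (h0 : t i₀ ≠ 0) (hc : t i₀ ≠ c) : ∃ i ∈ s, i ≠ i₀ ∧ t i ≠ 0 ∧ t i ≠ c := by
  classical
  have hsplit := Finset.add_sum_erase s t hi₀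
  have hne : ∑ i ∈ s.erase i₀, t i ≠ 0 := fun h => hc (by linarith)
  obtain ⟨i, hi, hti⟩ := Finset.exists_ne_zero_of_sum_ne_zero hne
  have hle : t i ≤ ∑ j ∈ s.erase i₀, t j :=
    Finset.single_le_sum (fun j hj => ht j (Finset.mem_of_mem_erase hj)) hi
  have hpos : 0 < t i₀ := (ht i₀ hi₀).lt_of_ne' h0
  exact ⟨i, Finset.mem_of_mem_erase hi, Finset.ne_of_mem_erase hi, hti, (by linarith : t i < c).ne⟩

/-- If `t ∈ 𝖫_G` and `t e₀ ∉ {0, 2}`, then each endpoint of `e₀` is incident to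
another edge whose weight is not `0` or `2`. -/
theorem exists_other_interior_edge (p : E → Vp) (q : E → Vn) (t : E → ℝ)
    (ht : t ∈ LGset p q) (e₀ : E) (h0 : t e₀ ≠ 0) (h2 : t e₀ ≠ 2) :
    (∃ e₁ : E, e₁ ≠ e₀ ∧ p e₁ = p e₀ ∧ t e₁ ≠ 0 ∧ t e₁ ≠ 2) ∧
    (∃ e₂ : E, e₂ ≠ e₀ ∧ q e₂ = q e₀ ∧ t e₂ ≠ 0 ∧ t e₂ ≠ 2) := by
  obtain ⟨⟨hp, hq⟩, hnn⟩ := ht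
  constructor
  · obtain ⟨e, he, hne, hte⟩ := Finset.exists_ne_and_ne_zero_and_ne_of_sum_eq
      (fun e _ => hnn e) (hp (p e₀)) (by simp) h0 h2
    exact ⟨e, hne, (Finset.mem_filter.mp he).2, hte⟩
  · obtain ⟨e, he, hne, hte⟩ := Finset.exists_ne_and_ne_zero_and_ne_of_sum_eq
      (fun e _ => hnn e) (hq (q e₀)) (by simp) h0 h2
    exact ⟨e, hne, (Finset.mem_filter.mp he).2, hte⟩
end

section
/- Let G be a finite bipartite multigraph and let t ∈ 𝖫_G be a nonnegative solution of L_G such that t e ∉ {0, 2} for at least one edge e. Then there exist t', t'' ∈ 𝖫_G with t lying in the open segment between t' and t'', and such that both t' and t'' have strictly more coordinates equal to 0 or 2 than t does: card { e | t' e = 0 ∨ t' e = 2 } > card { e | t e = 0 ∨ t e = 2 } and card { e | t'' e = 0 ∨ t'' e = 2 } > card { e | t e = 0 ∨ t e = 2 }. -/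
open Finset

variable {Vp Vn E : Type*} [Fintype Vp] [Fintype Vn] [Fintype E]
  [DecidableEq Vp] [DecidableEq Vn] [DecidableEq E]

/-- An edge whose weight is neither `0` nor `2` shares its vertex with another such edge. -/
lemma exists_ne_mem_fiber_of_sum_eq_two {V E : Type*} [Fintype E] [DecidableEq V]
    [DecidableEq E] (f : E → V) (t : E → ℝ) (hnn : ∀ e, 0 ≤ t e) (e : E)
    (hsum : ∑ x ∈ univ.filter (fun x => f x = f e), t x = 2) (h0 : t e ≠ 0) (h2 : t e ≠ 2) :
    ∃ x, x ≠ e ∧ f x = f e ∧ t x ≠ 0 ∧ t x ≠ 2 := by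
  by_contra! hcon
  have he : e ∈ univ.filter (fun x => f x = f e) := by simp
  have hpos : 0 < t e := lt_of_le_of_ne (hnn e) (Ne.symm h0)
  rw [← Finset.add_sum_erase _ _ he] at hsum
  have hzero : ∑ x ∈ (univ.filter (fun x => f x = f e)).erase e, t x = 0 := by
    refine Finset.sum_eq_zero fun x hx => ?_
    by_contra hx0
    have hle := Finset.single_le_sum (f := t) (fun y _ => hnn y) hx
    simp only [mem_erase, mem_filter, mem_univ, true_and] at hx
    have := hcon x hx.1 hx.2 hx0
    linarith
  exact h2 (by linarith)

/-- If every nonempty fiber of `f` on `F` has at least two elements, then the image of `F`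
has at most half as many elements as `F`. -/
lemma two_mul_card_image_le {V E : Type*} [DecidableEq V] (f : E → V)
    (F : Finset E) (hF : ∀ e ∈ F, ∃ x ∈ F, x ≠ e ∧ f x = f e) :
    2 * (F.image f).card ≤ F.card := by
  rw [Finset.card_eq_sum_card_image f F, mul_comm, ← smul_eq_mul]
  refine Finset.card_nsmul_le_sum _ _ _ fun v hv => ?_
  obtain ⟨e, he, rfl⟩ := Finset.mem_image.1 hv
  obtain ⟨x, hx, hne, hfx⟩ := hF e he
  exact Finset.one_lt_card.2 ⟨x, by simp [hx, hfx], e, by simp [he], hne⟩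

/-- A nonempty set of edges in which every vertex has degree `0` or at least `2` supports
a nonzero solution of the homogeneous system. -/
lemma exists_ne_zero_fiber_sums_eq_zero {V W E : Type*} [Fintype E] [DecidableEq V]
    [DecidableEq W] (p : E → V) (q : E → W) (F : Finset E)
    (hne : F.Nonempty) (hp : ∀ e ∈ F, ∃ x ∈ F, x ≠ e ∧ p x = p e)
    (hq : ∀ e ∈ F, ∃ x ∈ F, x ≠ e ∧ q x = q e) :
    ∃ s : E → ℝ, s ≠ 0 ∧ (∀ e ∉ F, s e = 0) ∧
      (∀ v, ∑ e ∈ univ.filter (fun e => p e = v), s e = 0) ∧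
      (∀ v, ∑ e ∈ univ.filter (fun e => q e = v), s e = 0) := by
  classical
  let A : (F → ℝ) →ₗ[ℝ] (F.image p → ℝ) × (F.image q → ℝ) :=
    LinearMap.prod
      (LinearMap.pi fun v => ∑ e ∈ univ.filter (fun e : F => p e = v), LinearMap.proj e)
      (LinearMap.pi fun v => ∑ e ∈ univ.filter (fun e : F => q e = v), LinearMap.proj e)
  have hA1 : ∀ s v, (A s).1 v = ∑ e ∈ univ.filter (fun e : F => p e = v), s e := by
    intro s v; simp [A]
  have hA2 : ∀ s v, (A s).2 v = ∑ e ∈ univ.filter (fun e : F => q e = v), s e := by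
    intro s v; simp [A]
  have hsum1 : ∀ s, ∑ v, (A s).1 v = ∑ e, s e := by
    intro s
    simp only [hA1]
    rw [← Finset.sum_fiberwise univ
      (fun e : F => (⟨p e, mem_image_of_mem p e.2⟩ : F.image p)) s]
    simp [Subtype.ext_iff]
  have hsum2 : ∀ s, ∑ v, (A s).2 v = ∑ e, s e := by
    intro s
    simp only [hA2]
    rw [← Finset.sum_fiberwise univ
      (fun e : F => (⟨q e, mem_image_of_mem q e.2⟩ : F.image q)) s]
    simp [Subtype.ext_iff]
  have hninj : ¬ Function.Injective A := by
    intro hinj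
    have hle := LinearMap.finrank_le_finrank_of_injective hinj
    have hcp := two_mul_card_image_le p F hp
    have hcq := two_mul_card_image_le q F hq
    have heq : Module.finrank ℝ (F → ℝ) =
        Module.finrank ℝ ((F.image p → ℝ) × (F.image q → ℝ)) := by
      refine le_antisymm hle ?_
      simp only [Module.finrank_prod, Module.finrank_fintype_fun_eq_card, Fintype.card_coe]
      omega
    have hsurj := (LinearMap.injective_iff_surjective_of_finrank_eq_finrank heq).1 hinj
    obtain ⟨e, he⟩ := hne
    obtain ⟨s, hs⟩ := hsurj (Pi.single ⟨p e, mem_image_of_mem p he⟩ 1, 0)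
    have h1 := hsum1 s
    have h2 := hsum2 s
    rw [hs] at h1 h2
    simp at h1 h2
    linarith
  rw [← LinearMap.ker_eq_bot, Submodule.eq_bot_iff] at hninj
  push Not at hninj
  obtain ⟨s, hs, hs0⟩ := hninj
  rw [LinearMap.mem_ker] at hs
  have hext : ∀ (P : E → Prop) [DecidablePred P],
      ∑ e ∈ univ.filter P, (if h : e ∈ F then s ⟨e, h⟩ else 0) =
        ∑ e ∈ univ.filter (fun e : F => P e), s e := by
    intro P _
    rw [Finset.sum_filter, Finset.sum_filter,
      ← Finset.sum_subset (Finset.subset_univ F) (by intro x _ hx; simp [hx]),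
      ← Finset.sum_coe_sort F]
    simp
  refine ⟨fun e => if h : e ∈ F then s ⟨e, h⟩ else 0, ?_, fun e he => by simp [he], ?_, ?_⟩
  · intro h
    apply hs0
    ext e
    simpa using congrFun h e
  · intro v
    rw [hext]
    by_cases hv : v ∈ F.image p
    · rw [← hA1 s ⟨v, hv⟩, hs]; rfl
    · refine Finset.sum_eq_zero fun e he => (hv ?_).elim
      rw [← (mem_filter.1 he).2]
      exact mem_image_of_mem p e.2
  · intro v
    rw [hext]
    by_cases hv : v ∈ F.image q
    · rw [← hA2 s ⟨v, hv⟩, hs]; rfl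
    · refine Finset.sum_eq_zero fun e he => (hv ?_).elim
      rw [← (mem_filter.1 he).2]
      exact mem_image_of_mem q e.2

/-- Moving from a point of `𝖫_G` along a homogeneous direction supported on the
coordinates different from `0` and `2` until the boundary is hit
increases the number of coordinates equal to `0` or `2`. -/
lemma exists_pos_add_smul_mem_LGset {Vp Vn E : Type*} [Fintype E]
    [DecidableEq Vp] [DecidableEq Vn] (p : E → Vp) (q : E → Vn) (t s : E → ℝ)
    (ht : t ∈ LGset p q) (hs0 : s ≠ 0) (hsupp : ∀ e, t e = 0 ∨ t e = 2 → s e = 0)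
    (hsp : ∀ v, ∑ e ∈ univ.filter (fun e => p e = v), s e = 0)
    (hsq : ∀ v, ∑ e ∈ univ.filter (fun e => q e = v), s e = 0) :
    ∃ a : ℝ, 0 < a ∧ t + a • s ∈ LGset p q ∧
      Nat.card {e : E | t e = 0 ∨ t e = 2} <
        Nat.card {e : E | (t + a • s) e = 0 ∨ (t + a • s) e = 2} := by
  obtain ⟨⟨htp, htq⟩, hnn⟩ := ht
  have hneg : (univ.filter (fun e => s e < 0)).Nonempty := by
    by_contra hcon
    have hge : ∀ e, 0 ≤ s e := by
      intro e
      by_contra he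
      exact hcon ⟨e, by simpa using he⟩
    apply hs0
    ext e
    exact (Finset.sum_eq_zero_iff_of_nonneg (fun x _ => hge x)).1 (hsp (p e)) e (by simp)
  obtain ⟨m, hm, hmin⟩ := Finset.exists_min_image _ (fun e => t e / (-s e)) hneg
  simp only [mem_filter, mem_univ, true_and] at hm hmin
  have hm0 : ¬ (t m = 0 ∨ t m = 2) := fun h => hm.ne (hsupp m h)
  have htm : 0 < t m := lt_of_le_of_ne (hnn m) fun h => hm0 (Or.inl h.symm)
  have ha : 0 < t m / (-s m) := div_pos htm (neg_pos.2 hm)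
  have hzero : t m + t m / (-s m) * s m = 0 := by
    have := hm.ne
    field_simp
    ring
  refine ⟨t m / (-s m), ha, ⟨⟨fun v => ?_, fun v => ?_⟩, fun e => ?_⟩, ?_⟩
  · simp [Finset.sum_add_distrib, ← Finset.mul_sum, htp, hsp]
  · simp [Finset.sum_add_distrib, ← Finset.mul_sum, htq, hsq]
  · simp only [Pi.add_apply, Pi.smul_apply, smul_eq_mul]
    rcases lt_or_ge (s e) 0 with he | he
    · have := (le_div_iff₀ (neg_pos.2 he)).1 (hmin e he)
      linarith
    · exact add_nonneg (hnn e) (mul_nonneg ha.le he)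
  · refine Set.ncard_lt_ncard (Set.ssubset_iff_of_subset ?_ |>.2 ⟨m, Or.inl hzero, hm0⟩)
      (Set.toFinite _)
    intro e he
    have hse := hsupp e he
    simpa [hse] using he

/-- If `t ∈ 𝖫_G` has some coordinate not equal to `0` or `2`, then `t` lies in the
open segment between two points `t', t'' ∈ 𝖫_G` each of which has strictly more
coordinates equal to `0` or `2` than `t` does. -/
theorem exists_openSegment_more_extreme_coords (p : E → Vp) (q : E → Vn) (t : E → ℝ)
    (ht : t ∈ LGset p q) (e : E) (h0 : t e ≠ 0) (h2 : t e ≠ 2) :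
    ∃ t' t'' : E → ℝ, t' ∈ LGset p q ∧ t'' ∈ LGset p q ∧
      t ∈ openSegment ℝ t' t'' ∧
      Nat.card {e : E | t e = 0 ∨ t e = 2} < Nat.card {e : E | t' e = 0 ∨ t' e = 2} ∧
      Nat.card {e : E | t e = 0 ∨ t e = 2} < Nat.card {e : E | t'' e = 0 ∨ t'' e = 2} := by
  have hnn := ht.2
  obtain ⟨s, hs0, hsF, hsp, hsq⟩ := exists_ne_zero_fiber_sums_eq_zero p q
    (univ.filter fun x => t x ≠ 0 ∧ t x ≠ 2) ⟨e, by simp [h0, h2]⟩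
    (fun x hx => by
      simp only [mem_filter, mem_univ, true_and] at hx ⊢
      obtain ⟨y, hy, hpy, hy0, hy2⟩ :=
        exists_ne_mem_fiber_of_sum_eq_two p t hnn x (ht.1.1 _) hx.1 hx.2
      exact ⟨y, ⟨hy0, hy2⟩, hy, hpy⟩)
    (fun x hx => by
      simp only [mem_filter, mem_univ, true_and] at hx ⊢
      obtain ⟨y, hy, hqy, hy0, hy2⟩ :=
        exists_ne_mem_fiber_of_sum_eq_two q t hnn x (ht.1.2 _) hx.1 hx.2
      exact ⟨y, ⟨hy0, hy2⟩, hy, hqy⟩)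
  have hsupp : ∀ x, t x = 0 ∨ t x = 2 → s x = 0 := by
    intro x hx
    refine hsF x fun hmem => ?_
    simp only [mem_filter, mem_univ, true_and] at hmem
    exact hx.elim hmem.1 hmem.2
  obtain ⟨a, ha, hta, hca⟩ := exists_pos_add_smul_mem_LGset p q t s ht hs0 hsupp hsp hsq
  obtain ⟨b, hb, htb, hcb⟩ := exists_pos_add_smul_mem_LGset p q t (-s) ht (neg_ne_zero.2 hs0)
    (fun x hx => by simp [hsupp x hx]) (fun v => by simp [hsp]) (fun v => by simp [hsq])
  have hab : a + b ≠ 0 := (add_pos ha hb).ne'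
  refine ⟨_, _, hta, htb, ⟨b / (a + b), a / (a + b), by positivity, by positivity, ?_, ?_⟩,
    hca, hcb⟩
  · field_simp
    ring
  · ext x
    simp only [Pi.add_apply, Pi.smul_apply, Pi.neg_apply, smul_eq_mul]
    field_simp
    ring
end
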